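/- Let p be an odd prime and G = H₃((ℤ/pℤ) × (ℤ/pℤ)). For every 2-cocycle α of G with values in ℂˣ there exist λ₁, ..., λ₈ ∈ ℂˣ with λᵢᵖ = 1 such that α is cohomologous to the 2-cocycle α' given by α'(g(a₁,a₂,b₁,b₂,c₁,c₂), g(a₁',a₂',b₁',b₂',c₁',c₂')) = λ₁^{c₁'a₁ + b₁C(a₁') + a₁b₁a₁'} · λ₂^{c₁'b₁ + a₁'C(b₁)} · λ₃^{c₂'a₂ + b₂C(a₂') + a₂b₂a₂'} · λ₄^{c₂'b₂ + a₂'C(b₂)} · λ₅^{a₁'a₂} · λ₆^{a₁'b₂} · λ₇^{b₁'a₂} · λ₈^{b₁'b₂}. -/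

import Mathlib

/-- The Heisenberg group `H₃(R)` of 3×3 upper unitriangular matrices over a commutative
ring `R`.  An element is determined by its entries: `b` is the (1,2)-entry, `a` is the
(2,3)-entry and `c` is the (1,3)-entry; multiplication is matrix multiplication. -/
@[ext]
structure Heisenberg (R : Type*) [CommRing R] where
  a : R
  b : R
  c : R

namespace Heisenberg

variable {R : Type*} [CommRing R]

instance : Mul (Heisenberg R) :=
  ⟨fun x y => ⟨x.a + y.a, x.b + y.b, x.c + y.c + x.b * y.a⟩⟩

instance : One (Heisenberg R) := ⟨⟨0, 0, 0⟩⟩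

instance : Inv (Heisenberg R) := ⟨fun x => ⟨-x.a, -x.b, -x.c + x.b * x.a⟩⟩

@[simp] lemma mul_a (x y : Heisenberg R) : (x * y).a = x.a + y.a := rfl
@[simp] lemma mul_b (x y : Heisenberg R) : (x * y).b = x.b + y.b := rfl
@[simp] lemma mul_c (x y : Heisenberg R) : (x * y).c = x.c + y.c + x.b * y.a := rfl
@[simp] lemma one_a : (1 : Heisenberg R).a = 0 := rfl
@[simp] lemma one_b : (1 : Heisenberg R).b = 0 := rfl
@[simp] lemma one_c : (1 : Heisenberg R).c = 0 := rfl
@[simp] lemma inv_a (x : Heisenberg R) : x⁻¹.a = -x.a := rfl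
@[simp] lemma inv_b (x : Heisenberg R) : x⁻¹.b = -x.b := rfl
@[simp] lemma inv_c (x : Heisenberg R) : x⁻¹.c = -x.c + x.b * x.a := rfl

/-- Matrix multiplication of unitriangular matrices makes `H₃(R)` a group. -/
instance : Group (Heisenberg R) where
  mul := (· * ·)
  one := 1
  inv := (·⁻¹)
  mul_assoc x y z := by ext <;> simp only [mul_a, mul_b, mul_c] <;> ring
  one_mul x := by ext <;> simp only [mul_a, mul_b, mul_c, one_a, one_b, one_c] <;> ring
  mul_one x := by ext <;> simp only [mul_a, mul_b, mul_c, one_a, one_b, one_c] <;> ring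
  inv_mul_cancel x := by
    ext <;> simp only [mul_a, mul_b, mul_c, inv_a, inv_b, inv_c, one_a, one_b, one_c] <;> ring

end Heisenberg

section Cocycles

variable {G : Type*} [Group G]

/-- A (normalized) `2`-cocycle of `G` with values in `ℂˣ` (trivial action):
`α(1,1) = 1` and `α(x,y)α(xy,z) = α(x,yz)α(y,z)`. -/
def IsMul2Cocycle (α : G × G → ℂˣ) : Prop :=
  α (1, 1) = 1 ∧ ∀ x y z : G, α (x, y) * α (x * y, z) = α (x, y * z) * α (y, z)

/-- Two `2`-cocycles `α, α'` are cohomologous if they differ by a `2`-coboundary: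
`α'(x,y) = f(x)f(y)f(xy)⁻¹α(x,y)` for some `f : G → ℂˣ` with `f 1 = 1`. -/
def IsCohomologous (α α' : G × G → ℂˣ) : Prop :=
  ∃ f : G → ℂˣ, f 1 = 1 ∧ ∀ x y : G, α' (x, y) = f x * f y * (f (x * y))⁻¹ * α (x, y)

end Cocycles

/-- `C(x) = x(x-1)/2` (2 is invertible in `ZMod n` for odd `n`). -/
def Cb {n : ℕ} (x : ZMod n) : ZMod n := x * (x - 1) * (2 : ZMod n)⁻¹

section ScalarGroup

variable {M E : Type*} [CommGroup M] [Group E] [MulAction M E] [IsScalarTower M E E]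
  [SMulCommClass M E E]

lemma pow_mul_pow_of_mul_eq_smul {A B : E} {u : M} (h : A * B = u • (B * A)) (m n : ℕ) :
    A ^ m * B ^ n = u ^ (m * n) • (B ^ n * A ^ m) := by
  have h₁ (k : ℕ) : A ^ k * B = u ^ k • (B * A ^ k) := by
    induction k with
    | zero => simp
    | succ k ih =>
      rw [pow_succ, mul_assoc, h, mul_smul_comm, ← mul_assoc, ih, smul_mul_assoc, smul_smul,
        mul_assoc, ← pow_succ']
  induction n with
  | zero => simp
  | succ n ih =>
    rw [pow_succ B, ← mul_assoc, ih, smul_mul_assoc, mul_assoc, h₁, mul_smul_comm, smul_smul,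
      ← pow_add, ← mul_assoc, Nat.mul_succ]

lemma pow_eq_one_of_mul_eq_smul [IsCancelSMul M E] {A B : E} {u : M} {p : ℕ}
    (h : A * B = u • (B * A)) (hA : A ^ p = 1) : u ^ p = 1 := by
  have := pow_mul_pow_of_mul_eq_smul h p 1
  rw [hA, one_mul, mul_one, mul_one] at this
  exact IsCancelSMul.right_cancel _ _ (B ^ 1) (by rw [← this, one_smul])

/-- The relations satisfied by lifts `X`, `Y`, `Z` of the standard generators of a Heisenberg
group to an extension by central scalars. -/
structure HeisenbergRelations (l m : M) (X Y Z : E) : Prop where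
  yx : Y * X = Z * (X * Y)
  xz : X * Z = l • (Z * X)
  yz : Y * Z = m • (Z * Y)

namespace HeisenbergRelations

variable {l m : M} {X Y Z : E}

lemma pow_mul_left (h : HeisenbergRelations l m X Y Z) (b : ℕ) :
    Y ^ b * X = m ^ b.choose 2 • (Z ^ b * (X * Y ^ b)) := by
  induction b with
  | zero => simp
  | succ b ih =>
    have hz := pow_mul_pow_of_mul_eq_smul h.yz 1 b
    rw [pow_one, one_mul] at hz
    rw [pow_succ', mul_assoc, ih, mul_smul_comm, ← mul_assoc, hz, smul_mul_assoc, smul_smul,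
      ← pow_add, mul_assoc, ← mul_assoc Y X, h.yx, Nat.choose_succ_succ' b 1, Nat.choose_one_right,
      pow_succ Z]
    simp only [mul_assoc, one_add_one_eq_two, add_comm]

lemma pow_mul_pow (h : HeisenbergRelations l m X Y Z) (a b : ℕ) :
    Y ^ b * X ^ a =
      (l ^ (b * a.choose 2) * m ^ (a * b.choose 2)) • (Z ^ (b * a) * (X ^ a * Y ^ b)) := by
  induction a with
  | zero => simp
  | succ a ih =>
    calc Y ^ b * X ^ (a + 1) = Y ^ b * X ^ a * X := by rw [pow_succ, mul_assoc]
      _ = (l ^ (b * a.choose 2) * m ^ (a * b.choose 2)) •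
            (Z ^ (b * a) * (X ^ a * (Y ^ b * X))) := by
        rw [ih, smul_mul_assoc]; simp only [mul_assoc]
      _ = (l ^ (b * a.choose 2) * m ^ (a * b.choose 2) * m ^ b.choose 2) •
            (Z ^ (b * a) * ((X ^ a * Z ^ b) * (X * Y ^ b))) := by
        rw [h.pow_mul_left]; simp only [mul_smul_comm, smul_smul, mul_assoc]
      _ = (l ^ (b * a.choose 2) * m ^ (a * b.choose 2) * m ^ b.choose 2 * l ^ (a * b)) •
            (Z ^ (b * a) * Z ^ b * (X ^ a * X * Y ^ b)) := by
        rw [pow_mul_pow_of_mul_eq_smul h.xz]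
        simp only [mul_smul_comm, smul_mul_assoc, smul_smul, mul_assoc]
      _ = _ := by
        rw [← pow_add, ← pow_succ, Nat.choose_succ_succ' a 1, Nat.choose_one_right]
        congr 1
        simp only [mul_add, add_mul, one_mul, pow_add, one_add_one_eq_two, mul_comm, mul_left_comm,
          mul_assoc]

/-- Product of two words in normal form. -/
lemma word_mul_word (h : HeisenbergRelations l m X Y Z) (a b c a' b' c' : ℕ) :
    Z ^ c * X ^ a * Y ^ b * (Z ^ c' * X ^ a' * Y ^ b') =
      (l ^ (c' * a + b * a'.choose 2 + a * b * a') * m ^ (c' * b + a' * b.choose 2)) •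
        (Z ^ (c + c' + b * a') * X ^ (a + a') * Y ^ (b + b')) := by
  calc Z ^ c * X ^ a * Y ^ b * (Z ^ c' * X ^ a' * Y ^ b')
      = Z ^ c * (X ^ a * ((Y ^ b * Z ^ c') * (X ^ a' * Y ^ b'))) := by simp only [mul_assoc]
    _ = m ^ (b * c') • (Z ^ c * ((X ^ a * Z ^ c') * ((Y ^ b * X ^ a') * Y ^ b'))) := by
      rw [pow_mul_pow_of_mul_eq_smul h.yz]
      simp only [mul_smul_comm, smul_mul_assoc, mul_assoc]
    _ = (m ^ (b * c') * (l ^ (a * c') * (l ^ (b * a'.choose 2) * m ^ (a' * b.choose 2)))) •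
          (Z ^ c * (Z ^ c' * ((X ^ a * Z ^ (b * a')) * (X ^ a' * (Y ^ b * Y ^ b'))))) := by
      rw [pow_mul_pow_of_mul_eq_smul h.xz, h.pow_mul_pow]
      simp only [mul_smul_comm, smul_mul_assoc, smul_smul, mul_assoc]
      simp only [mul_comm, mul_left_comm, mul_assoc]
    _ = (m ^ (b * c') * (l ^ (a * c') * (l ^ (b * a'.choose 2) * m ^ (a' * b.choose 2))) *
          l ^ (a * (b * a'))) •
          ((Z ^ c * Z ^ c' * Z ^ (b * a')) * (X ^ a * X ^ a') * (Y ^ b * Y ^ b')) := by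
      rw [pow_mul_pow_of_mul_eq_smul h.xz]
      simp only [mul_smul_comm, smul_mul_assoc, smul_smul, mul_assoc]
    _ = _ := by
      simp only [← pow_add]
      congr 1
      simp only [pow_add, mul_comm, mul_left_comm, mul_assoc]

lemma commute_of_mul_eq_smul (h : HeisenbergRelations l m X Y Z) {A : E} {u v : M}
    (hX : A * X = u • (X * A)) (hY : A * Y = v • (Y * A)) : A * Z = Z * A := by
  have h₁ : A * (Y * X) = (v * u) • (Y * X * A) := by
    rw [← mul_assoc, hY, smul_mul_assoc, mul_assoc, hX, mul_smul_comm, smul_smul, mul_assoc]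
  have h₂ : A * (X * Y) = (v * u) • (X * Y * A) := by
    rw [← mul_assoc, hX, smul_mul_assoc, mul_assoc, hY, mul_smul_comm, smul_smul, mul_assoc,
      mul_comm u]
  have h₃ : A * Z * (X * Y) = Z * A * (X * Y) := by
    rw [mul_assoc, ← h.yx, h₁, mul_assoc Z, h₂, h.yx, mul_smul_comm, mul_assoc Z]
  exact mul_right_cancel h₃

lemma pow_mul_word (h : HeisenbergRelations l m X Y Z) {A : E} {u v : M}
    (hX : A * X = u • (X * A)) (hY : A * Y = v • (Y * A)) (n a b c : ℕ) :
    A ^ n * (Z ^ c * X ^ a * Y ^ b) =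
      (u ^ (a * n) * v ^ (b * n)) • (Z ^ c * X ^ a * Y ^ b * A ^ n) := by
  have hZ : Commute (A ^ n) (Z ^ c) := Commute.pow_pow (h.commute_of_mul_eq_smul hX hY) n c
  rw [mul_assoc (Z ^ c), ← mul_assoc, hZ.eq, mul_assoc, ← mul_assoc (A ^ n),
    pow_mul_pow_of_mul_eq_smul hX, smul_mul_assoc, mul_assoc (X ^ a),
    pow_mul_pow_of_mul_eq_smul hY]
  simp only [mul_smul_comm, smul_smul, mul_assoc, mul_comm n]

variable {p : ℕ}

lemma center_pow_eq_one [IsCancelSMul M E] (h : HeisenbergRelations l m X Y Z) (hp : Odd p)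
    (hX : X ^ p = 1) : Z ^ p = 1 := by
  have hl : l ^ p.choose 2 = 1 := by
    obtain ⟨k, rfl⟩ := hp
    rw [Nat.choose_two_right, Nat.add_sub_cancel, mul_left_comm,
      Nat.mul_div_cancel_left _ two_pos, pow_mul, pow_eq_one_of_mul_eq_smul h.xz hX, one_pow]
  have := h.pow_mul_pow p 1
  simp only [hX, pow_one, one_mul, mul_one, hl, Nat.choose_succ_self, mul_zero, pow_zero,
    one_smul] at this
  exact mul_eq_right.mp this.symm

variable {l' m' u₁ u₂ u₃ u₄ : M} {X' Y' Z' : E}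

/-- Product of two words in normal form for a pair of Heisenberg triples commuting up to
scalars. -/
lemma word_mul_word_pair (h : HeisenbergRelations l m X Y Z)
    (h' : HeisenbergRelations l' m' X' Y' Z')
    (h₁ : X' * X = u₁ • (X * X')) (h₂ : Y' * X = u₂ • (X * Y'))
    (h₃ : X' * Y = u₃ • (Y * X')) (h₄ : Y' * Y = u₄ • (Y * Y'))
    (a b c a' b' c' d e f d' e' f' : ℕ) :
    Z ^ c * X ^ a * Y ^ b * (Z' ^ f * X' ^ d * Y' ^ e) *
        (Z ^ c' * X ^ a' * Y ^ b' * (Z' ^ f' * X' ^ d' * Y' ^ e')) =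
      (l ^ (c' * a + b * a'.choose 2 + a * b * a') * m ^ (c' * b + a' * b.choose 2) *
        l' ^ (f' * d + e * d'.choose 2 + d * e * d') * m' ^ (f' * e + d' * e.choose 2) *
        u₁ ^ (a' * d) * u₂ ^ (a' * e) * u₃ ^ (b' * d) * u₄ ^ (b' * e)) •
        (Z ^ (c + c' + b * a') * X ^ (a + a') * Y ^ (b + b') *
          (Z' ^ (f + f' + e * d') * X' ^ (d + d') * Y' ^ (e + e'))) := by
  have symm {A B : E} {u : M} (hAB : A * B = u • (B * A)) : B * A = u⁻¹ • (A * B) := by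
    rw [hAB, inv_smul_smul]
  have hXZ := h'.commute_of_mul_eq_smul (symm h₁) (symm h₂)
  have hYZ := h'.commute_of_mul_eq_smul (symm h₃) (symm h₄)
  have hZX : Z' * X = (1 : M) • (X * Z') := by rw [one_smul, hXZ]
  have hZY : Z' * Y = (1 : M) • (Y * Z') := by rw [one_smul, hYZ]
  calc
    _ = Z ^ c * X ^ a * Y ^ b *
        ((Z' ^ f * (X' ^ d * (Y' ^ e * (Z ^ c' * X ^ a' * Y ^ b')))) *
        (Z' ^ f' * X' ^ d' * Y' ^ e')) := by simp only [mul_assoc]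
    _ = (u₂ ^ (a' * e) * u₄ ^ (b' * e) * (u₁ ^ (a' * d) * u₃ ^ (b' * d))) •
        (Z ^ c * X ^ a * Y ^ b * (Z ^ c' * X ^ a' * Y ^ b') *
        ((Z' ^ f * X' ^ d * Y' ^ e) * (Z' ^ f' * X' ^ d' * Y' ^ e'))) := by
      rw [h.pow_mul_word h₂ h₄, mul_smul_comm, ← mul_assoc (X' ^ d), h.pow_mul_word h₁ h₃,
        smul_mul_assoc, mul_smul_comm, mul_smul_comm, mul_assoc _ (X' ^ d), ← mul_assoc (Z' ^ f),
        h.pow_mul_word hZX hZY]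
      simp only [one_pow, one_mul, one_smul, mul_smul_comm, smul_mul_assoc, smul_smul, mul_assoc]
    _ = _ := by
      rw [h.word_mul_word, h'.word_mul_word, smul_mul_assoc, mul_smul_comm, smul_smul, smul_smul]
      congr 1
      simp only [mul_comm, mul_left_comm, mul_assoc]

end HeisenbergRelations

end ScalarGroup

section CocycleExtension

variable {G : Type*} [Group G] {α : G × G → ℂˣ}

lemma IsMul2Cocycle.one_left (hα : IsMul2Cocycle α) (g : G) : α (1, g) = 1 := by
  have := hα.2 1 1 g
  rwa [one_mul, one_mul, hα.1, mul_right_cancel_iff, eq_comm] at this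

/-- The central extension of `G` by `ℂˣ` defined by a `2`-cocycle. -/
@[ext]
structure CocycleExtension (hα : IsMul2Cocycle α) where
  coeff : ℂˣ
  base : G

namespace CocycleExtension

variable {hα : IsMul2Cocycle α}

instance : Mul (CocycleExtension hα) :=
  ⟨fun x y => ⟨x.coeff * y.coeff * α (x.base, y.base), x.base * y.base⟩⟩

instance : One (CocycleExtension hα) := ⟨⟨1, 1⟩⟩

instance : Inv (CocycleExtension hα) :=
  ⟨fun x => ⟨x.coeff⁻¹ * (α (x.base⁻¹, x.base))⁻¹, x.base⁻¹⟩⟩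

@[simp] lemma coeff_mul (x y : CocycleExtension hα) :
    (x * y).coeff = x.coeff * y.coeff * α (x.base, y.base) := rfl
@[simp] lemma base_mul (x y : CocycleExtension hα) : (x * y).base = x.base * y.base := rfl
@[simp] lemma coeff_one : (1 : CocycleExtension hα).coeff = 1 := rfl
@[simp] lemma base_one : (1 : CocycleExtension hα).base = 1 := rfl
@[simp] lemma coeff_inv (x : CocycleExtension hα) :
    x⁻¹.coeff = x.coeff⁻¹ * (α (x.base⁻¹, x.base))⁻¹ := rfl
@[simp] lemma base_inv (x : CocycleExtension hα) : x⁻¹.base = x.base⁻¹ := rfl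

instance : Group (CocycleExtension hα) :=
  Group.ofLeftAxioms
    (fun x y z => by
      ext1
      · have := hα.2 x.base y.base z.base
        simp only [coeff_mul, base_mul]
        calc _ = x.coeff * y.coeff * z.coeff *
              (α (x.base, y.base) * α (x.base * y.base, z.base)) := by
              rw [mul_right_comm (x.coeff * y.coeff), mul_assoc (_ * z.coeff)]
          _ = _ := by rw [this]; simp only [mul_comm, mul_left_comm, mul_assoc]
      · simp [mul_assoc])
    (fun x => by ext1 <;> simp [hα.one_left])
    (fun x => by ext1 <;> simp [mul_assoc])

instance : MulAction ℂˣ (CocycleExtension hα) where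
  smul u x := ⟨u * x.coeff, x.base⟩
  one_smul _ := CocycleExtension.ext (one_mul _) rfl
  mul_smul _ _ _ := CocycleExtension.ext (mul_assoc _ _ _) rfl

@[simp] lemma coeff_smul (u : ℂˣ) (x : CocycleExtension hα) :
    (u • x).coeff = u * x.coeff := rfl
@[simp] lemma base_smul (u : ℂˣ) (x : CocycleExtension hα) : (u • x).base = x.base := rfl

instance : IsScalarTower ℂˣ (CocycleExtension hα) (CocycleExtension hα) :=
  ⟨fun u x y => by ext1 <;> simp [mul_assoc]⟩

instance : SMulCommClass ℂˣ (CocycleExtension hα) (CocycleExtension hα) :=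
  ⟨fun u x y => by ext1 <;> simp [mul_left_comm, mul_assoc]⟩

instance : IsCancelSMul ℂˣ (CocycleExtension hα) where
  left_cancel' u _ _ h := MulAction.injective u h
  right_cancel' _ _ x h := mul_right_cancel (b := x.coeff) (congrArg coeff h)

lemma exists_eq_smul {x y : CocycleExtension hα} (h : x.base = y.base) : ∃ u : ℂˣ, x = u • y :=
  ⟨x.coeff * y.coeff⁻¹, by ext1 <;> simp [h]⟩

lemma exists_mul_eq_smul {x y : CocycleExtension hα} (h : x.base * y.base = y.base * x.base) :
    ∃ u : ℂˣ, x * y = u • (y * x) :=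
  exists_eq_smul h

variable (hα) in
/-- The projection onto the base group. -/
@[simps]
def baseHom : CocycleExtension hα →* G where
  toFun := base
  map_one' := rfl
  map_mul' _ _ := rfl

@[simp] lemma base_pow (x : CocycleExtension hα) (n : ℕ) : (x ^ n).base = x.base ^ n :=
  map_pow (baseHom hα) x n

lemma exists_lift_pow_eq_one (hα : IsMul2Cocycle α) {g : G} {n : ℕ} (hn : n ≠ 0)
    (hg : g ^ n = 1) : ∃ x : CocycleExtension hα, x.base = g ∧ x ^ n = 1 := by
  obtain ⟨u, hu⟩ := exists_eq_smul (x := (⟨1, g⟩ : CocycleExtension hα) ^ n) (y := 1)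
    (by simpa using hg)
  obtain ⟨v, hv⟩ := IsAlgClosed.exists_pow_nat_eq (u⁻¹ : ℂˣ).val (Nat.pos_of_ne_zero hn)
  have hv₀ : v ≠ 0 := by
    rintro rfl
    rw [zero_pow hn] at hv
    exact (u⁻¹).ne_zero hv.symm
  have hv' : Units.mk0 v hv₀ ^ n = u⁻¹ := Units.ext (by simpa using hv)
  exact ⟨Units.mk0 v hv₀ • ⟨1, g⟩, rfl, by rw [smul_pow, hu, hv', inv_smul_smul]⟩

/-- A section of the extension whose factor set is `β` shows that `α` is cohomologous to `β`. -/
lemma isCohomologous_of_section {β : G × G → ℂˣ} (s : G → CocycleExtension hα)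
    (hs : ∀ g, (s g).base = g) (hs₁ : s 1 = 1)
    (hmul : ∀ g h, s g * s h = β (g, h) • s (g * h)) : IsCohomologous α β := by
  refine ⟨fun g => (s g).coeff, by simp [hs₁], fun g h => ?_⟩
  have := congrArg coeff (hmul g h)
  simp only [coeff_mul, coeff_smul, hs] at this
  rw [mul_right_comm, this, mul_inv_cancel_right]

end CocycleExtension

end CocycleExtension

namespace Heisenberg

variable {R : Type*} [CommRing R]

lemma mk_a_pow (r : R) (n : ℕ) : (⟨r, 0, 0⟩ : Heisenberg R) ^ n = ⟨n * r, 0, 0⟩ := by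
  induction n with
  | zero => ext <;> simp
  | succ n ih => rw [pow_succ, ih]; ext <;> simp [add_mul]

lemma mk_b_pow (r : R) (n : ℕ) : (⟨0, r, 0⟩ : Heisenberg R) ^ n = ⟨0, n * r, 0⟩ := by
  induction n with
  | zero => ext <;> simp
  | succ n ih => rw [pow_succ, ih]; ext <;> simp [add_mul]

lemma mk_c_pow (r : R) (n : ℕ) : (⟨0, 0, r⟩ : Heisenberg R) ^ n = ⟨0, 0, n * r⟩ := by
  induction n with
  | zero => ext <;> simp
  | succ n ih => rw [pow_succ, ih]; ext <;> simp [add_mul]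

end Heisenberg

section CentralTriple

variable {R : Type*} [CommRing R] {α : Heisenberg R × Heisenberg R → ℂˣ}

/-- Lifts of generators of the Heisenberg group over a subring generated by an idempotent. -/
lemma exists_lift_heisenbergRelations (hα : IsMul2Cocycle α) {p : ℕ} (hp : Odd p) {e : R}
    (he : e * e = e) (hpe : (p : R) * e = 0) :
    ∃ (l m : ℂˣ) (X Y Z : CocycleExtension hα), HeisenbergRelations l m X Y Z ∧
      X.base = ⟨e, 0, 0⟩ ∧ Y.base = ⟨0, e, 0⟩ ∧ Z.base = ⟨0, 0, e⟩ ∧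
      l ^ p = 1 ∧ m ^ p = 1 ∧ X ^ p = 1 ∧ Y ^ p = 1 ∧ Z ^ p = 1 := by
  obtain ⟨X, hX, hXp⟩ := CocycleExtension.exists_lift_pow_eq_one hα (n := p)
    (g := ⟨e, 0, 0⟩) hp.pos.ne' (by rw [Heisenberg.mk_a_pow, hpe]; rfl)
  obtain ⟨Y, hY, hYp⟩ := CocycleExtension.exists_lift_pow_eq_one hα (n := p)
    (g := ⟨0, e, 0⟩) hp.pos.ne' (by rw [Heisenberg.mk_b_pow, hpe]; rfl)
  have hZ : (Y * X * (X * Y)⁻¹).base = ⟨0, 0, e⟩ := by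
    simp only [CocycleExtension.base_mul, CocycleExtension.base_inv, hX, hY]
    ext <;> simp [he]
  obtain ⟨l, hl⟩ := CocycleExtension.exists_mul_eq_smul (x := X) (y := Y * X * (X * Y)⁻¹)
    (by rw [hZ, hX]; ext <;> simp)
  obtain ⟨m, hm⟩ := CocycleExtension.exists_mul_eq_smul (x := Y) (y := Y * X * (X * Y)⁻¹)
    (by rw [hZ, hY]; ext <;> simp)
  have h : HeisenbergRelations l m X Y (Y * X * (X * Y)⁻¹) :=
    ⟨(inv_mul_cancel_right _ _).symm, hl, hm⟩
  exact ⟨l, m, X, Y, _, h, hX, hY, hZ, pow_eq_one_of_mul_eq_smul h.xz hXp,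
    pow_eq_one_of_mul_eq_smul h.yz hYp, hXp, hYp, h.center_pow_eq_one hp hXp⟩

end CentralTriple

lemma natCast_choose_two_eq_Cb {p : ℕ} [Fact p.Prime] (hp : Odd p) (n : ℕ) :
    (n.choose 2 : ZMod p) = Cb (n : ZMod p) := by
  have h2 : (2 : ZMod p) ≠ 0 := by
    intro h
    have := (ZMod.natCast_eq_zero_iff 2 p).mp (by exact_mod_cast h)
    have := (Nat.prime_dvd_prime_iff_eq Fact.out Nat.prime_two).mp this
    subst this
    exact absurd hp (by decide)
  induction n with
  | zero => simp [Cb]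
  | succ n ih =>
    rw [Nat.choose_succ_succ' n 1, Nat.choose_one_right, Nat.cast_add, ih]
    simp only [Cb]
    push_cast
    field_simp
    ring

lemma pow_eq_pow_val {M : Type*} [Monoid M] {p : ℕ} {u : M} (hu : u ^ p = 1)
    {x : ZMod p} {n : ℕ} (h : (n : ZMod p) = x) : u ^ n = u ^ x.val := by
  rw [← h, ZMod.val_natCast, ← pow_eq_pow_mod n hu]

/-- Every `2`-cocycle of `H₃((ℤ/pℤ) × (ℤ/pℤ))`, `p` an odd prime, is cohomologous to one
of the standard form determined by scalars `λ₁, …, λ₈` with `λᵢᵖ = 1`.  Here an element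
of the group is the unitriangular matrix `g(a₁,a₂,b₁,b₂,c₁,c₂)` with `(1,2)`-entry
`(b₁,b₂)`, `(2,3)`-entry `(a₁,a₂)` and `(1,3)`-entry `(c₁,c₂)`. -/
theorem two_cocycle_classification_heisenberg_prod (p : ℕ) [Fact p.Prime] (hodd : Odd p)
    (α : Heisenberg (ZMod p × ZMod p) × Heisenberg (ZMod p × ZMod p) → ℂˣ)
    (hα : IsMul2Cocycle α) :
    ∃ l₁ l₂ l₃ l₄ l₅ l₆ l₇ l₈ : ℂˣ,
      l₁ ^ p = 1 ∧ l₂ ^ p = 1 ∧ l₃ ^ p = 1 ∧ l₄ ^ p = 1 ∧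
      l₅ ^ p = 1 ∧ l₆ ^ p = 1 ∧ l₇ ^ p = 1 ∧ l₈ ^ p = 1 ∧
      IsCohomologous α (fun q =>
        l₁ ^ ((q.2.c.1 * q.1.a.1 + q.1.b.1 * Cb q.2.a.1 +
               q.1.a.1 * q.1.b.1 * q.2.a.1).val) *
        l₂ ^ ((q.2.c.1 * q.1.b.1 + q.2.a.1 * Cb q.1.b.1).val) *
        l₃ ^ ((q.2.c.2 * q.1.a.2 + q.1.b.2 * Cb q.2.a.2 +
               q.1.a.2 * q.1.b.2 * q.2.a.2).val) *
        l₄ ^ ((q.2.c.2 * q.1.b.2 + q.2.a.2 * Cb q.1.b.2).val) *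
        l₅ ^ ((q.2.a.1 * q.1.a.2).val) *
        l₆ ^ ((q.2.a.1 * q.1.b.2).val) *
        l₇ ^ ((q.2.b.1 * q.1.a.2).val) *
        l₈ ^ ((q.2.b.1 * q.1.b.2).val)) := by
  have hp₀ : (p : ZMod p × ZMod p) = 0 := by ext <;> simp
  obtain ⟨l₁, l₂, X, Y, Z, h, hX, hY, hZ, hl₁, hl₂, hXp, hYp, hZp⟩ :=
    exists_lift_heisenbergRelations hα hodd (e := (1, 0)) (by simp) (by simp [hp₀])
  obtain ⟨l₃, l₄, X', Y', Z', h', hX', hY', hZ', hl₃, hl₄, hXp', hYp', hZp'⟩ :=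
    exists_lift_heisenbergRelations hα hodd (e := (0, 1)) (by simp) (by simp [hp₀])
  obtain ⟨l₅, h₅⟩ := CocycleExtension.exists_mul_eq_smul (x := X') (y := X)
    (by rw [hX, hX']; ext <;> simp)
  obtain ⟨l₆, h₆⟩ := CocycleExtension.exists_mul_eq_smul (x := Y') (y := X)
    (by rw [hX, hY']; ext <;> simp)
  obtain ⟨l₇, h₇⟩ := CocycleExtension.exists_mul_eq_smul (x := X') (y := Y)
    (by rw [hY, hX']; ext <;> simp)
  obtain ⟨l₈, h₈⟩ := CocycleExtension.exists_mul_eq_smul (x := Y') (y := Y)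
    (by rw [hY, hY']; ext <;> simp)
  have hl₅ := pow_eq_one_of_mul_eq_smul h₅ hXp'
  have hl₆ := pow_eq_one_of_mul_eq_smul h₆ hYp'
  have hl₇ := pow_eq_one_of_mul_eq_smul h₇ hXp'
  have hl₈ := pow_eq_one_of_mul_eq_smul h₈ hYp'
  refine ⟨l₁, l₂, l₃, l₄, l₅, l₆, l₇, l₈, hl₁, hl₂, hl₃, hl₄, hl₅, hl₆, hl₇, hl₈, ?_⟩
  refine CocycleExtension.isCohomologous_of_section (hα := hα)
    (fun g => Z ^ g.c.1.val * X ^ g.a.1.val * Y ^ g.b.1.val *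
      (Z' ^ g.c.2.val * X' ^ g.a.2.val * Y' ^ g.b.2.val)) (fun g => ?_) (by simp) (fun g k => ?_)
  · simp only [CocycleExtension.base_mul, CocycleExtension.base_pow, hX, hY, hZ, hX', hY', hZ',
      Heisenberg.mk_a_pow, Heisenberg.mk_b_pow, Heisenberg.mk_c_pow]
    ext <;> simp
  · simp only [Heisenberg.mul_a, Heisenberg.mul_b, Heisenberg.mul_c, Prod.fst_add, Prod.snd_add,
      Prod.fst_mul, Prod.snd_mul]
    rw [h.word_mul_word_pair h' h₅ h₆ h₇ h₈]
    congr 1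
    · iterate 7 congr 1
      exacts [pow_eq_pow_val hl₁ (by simp [natCast_choose_two_eq_Cb hodd]),
        pow_eq_pow_val hl₂ (by simp [natCast_choose_two_eq_Cb hodd]),
        pow_eq_pow_val hl₃ (by simp [natCast_choose_two_eq_Cb hodd]),
        pow_eq_pow_val hl₄ (by simp [natCast_choose_two_eq_Cb hodd]),
        pow_eq_pow_val hl₅ (by simp), pow_eq_pow_val hl₆ (by simp),
        pow_eq_pow_val hl₇ (by simp), pow_eq_pow_val hl₈ (by simp)]
    · congr 1 <;> congr 1
      · congr 1
        exacts [pow_eq_pow_val hZp (by simp), pow_eq_pow_val hXp (by simp)]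
      · exact pow_eq_pow_val hYp (by simp)
      · congr 1
        exacts [pow_eq_pow_val hZp' (by simp), pow_eq_pow_val hXp' (by simp)]
      · exact pow_eq_pow_val hYp' (by simp)
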